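/- Let (φ_i, ξ_i, η_i), i = 1,2,3, be an abelian almost 3-contact structure on a finite-dimensional real Lie algebra 𝔤, and set 𝒵 := φ_1([ξ_2, ξ_3]). Then ψ(𝒵) = 0, i.e. φ_1([ξ_1, 𝒵]) = 0, and consequently [ξ_i, 𝒵] = 0 for i = 1, 2, 3; in particular [ξ, 𝒵] = 0 for every ξ ∈ 𝔳. -/

import Mathlib

/-- `(i,j,k)` is an even permutation of `(1,2,3)` (indexed here as `(0,1,2)`). -/
def evenPerm (i j k : Fin 3) : Prop :=
  (i, j, k) = ((0 : Fin 3), (1 : Fin 3), (2 : Fin 3)) ∨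
  (i, j, k) = ((1 : Fin 3), (2 : Fin 3), (0 : Fin 3)) ∨
  (i, j, k) = ((2 : Fin 3), (0 : Fin 3), (1 : Fin 3))

/-- An abelian almost 3-contact structure on a real Lie algebra `L`: three almost
contact structures `(φ i, ξ i, η i)` satisfying the quaternionic-like compatibility
relations for every even permutation `(i,j,k)` of `(1,2,3)`, each of which is abelian. -/
structure AbelianAC3 (L : Type*) [LieRing L] [LieAlgebra ℝ L] where
  φ : Fin 3 → (L →ₗ[ℝ] L)
  ξ : Fin 3 → L
  η : Fin 3 → (L →ₗ[ℝ] ℝ)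
  acs : ∀ i, ∀ x : L, φ i (φ i x) = -x + η i x • ξ i
  unit : ∀ i, η i (ξ i) = 1
  comp_phi : ∀ i j k, evenPerm i j k → ∀ x : L, φ k x = φ i (φ j x) - η j x • ξ i
  comp_phi' : ∀ i j k, evenPerm i j k → ∀ x : L, φ k x = -φ j (φ i x) + η i x • ξ j
  comp_xi : ∀ i j k, evenPerm i j k → φ i (ξ j) = ξ k
  comp_xi' : ∀ i j k, evenPerm i j k → φ j (ξ i) = -ξ k
  comp_eta : ∀ i j k, evenPerm i j k → ∀ x : L, η i (φ j x) = η k x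
  comp_eta' : ∀ i j k, evenPerm i j k → ∀ x : L, η j (φ i x) = -η k x
  abelian_ad : ∀ i, ∀ x : L, ⁅ξ i, φ i x⁆ = φ i ⁅ξ i, x⁆
  abelian_br : ∀ i, ∀ X Y : L, η i X = 0 → η i Y = 0 → ⁅φ i X, φ i Y⁆ = ⁅X, Y⁆

namespace AbelianAC3

variable {L : Type*} [LieRing L] [LieAlgebra ℝ L]

/-- Membership in the horizontal subspace `𝔥 = ⋂ ker (η i)`. -/
def inH (S : AbelianAC3 L) (x : L) : Prop := ∀ i, S.η i x = 0

/-- The horizontal subspace `𝔥` as a submodule. -/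
def H (S : AbelianAC3 L) : Submodule ℝ L :=
  LinearMap.ker (S.η 0) ⊓ LinearMap.ker (S.η 1) ⊓ LinearMap.ker (S.η 2)

/-- The vertical subspace `𝔳 = span{ξ₁, ξ₂, ξ₃}`. -/
def V (S : AbelianAC3 L) : Submodule ℝ L :=
  Submodule.span ℝ {S.ξ 0, S.ξ 1, S.ξ 2}

/-- The endomorphism `ψ(X) = [ξ₁, φ₁ X]` (as a linear map on all of `L`). -/
def psi (S : AbelianAC3 L) : L →ₗ[ℝ] L :=
  (LieAlgebra.ad ℝ L (S.ξ 0)) ∘ₗ (S.φ 0)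

/-- The distinguished horizontal vector `𝒵 = φ₁([ξ₂, ξ₃])`. -/
def Z (S : AbelianAC3 L) : L := S.φ 0 ⁅S.ξ 1, S.ξ 2⁆

end AbelianAC3

theorem evenPerm.rotate {i j k : Fin 3} (h : evenPerm i j k) : evenPerm j k i := by
  rcases h with h | h | h <;> (cases h; simp [evenPerm])

namespace AbelianAC3

variable {L : Type*} [LieRing L] [LieAlgebra ℝ L] (S : AbelianAC3 L)

theorem phi_xi_self (i : Fin 3) : S.φ i (S.ξ i) = 0 := by
  have h0 : S.φ i (S.φ i (S.ξ i)) = 0 := by rw [S.acs, S.unit]; simp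
  have h1 := S.acs i (S.φ i (S.ξ i))
  rw [h0, map_zero] at h1
  have h2 : S.φ i (S.ξ i) = S.η i (S.φ i (S.ξ i)) • S.ξ i :=
    (neg_add_eq_zero.mp h1.symm)
  generalize S.η i (S.φ i (S.ξ i)) = a at h2
  have h3 : (a * a) • S.ξ i = 0 := by
    rw [mul_smul, ← h2, ← map_smul, ← h2, h0]
  have h4 := congrArg (S.η i) h3
  simp only [map_smul, S.unit, smul_eq_mul, mul_one, map_zero, mul_self_eq_zero] at h4
  rw [h2, h4, zero_smul]

theorem eta_phi_self (i : Fin 3) (x : L) : S.η i (S.φ i x) = 0 := by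
  have h := S.acs i (S.φ i x)
  rw [S.acs i x, map_add, map_neg, map_smul, S.phi_xi_self, smul_zero] at h
  simpa [S.unit] using (congrArg (S.η i) (add_left_cancel h)).symm

variable {S} {i j k : Fin 3}

theorem eta_xi_next (h : evenPerm i j k) : S.η i (S.ξ j) = 0 := by
  have h1 := S.comp_eta' j k i h.rotate (S.ξ j)
  rw [S.phi_xi_self, map_zero] at h1
  exact neg_eq_zero.mp h1.symm

theorem phi_lie_xi_next (h : evenPerm i j k) : S.φ i ⁅S.ξ i, S.ξ j⁆ = -⁅S.ξ k, S.ξ i⁆ := by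
  rw [← S.abelian_ad, S.comp_xi i j k h, lie_skew]

theorem phi_lie_xi_prev (h : evenPerm i j k) : S.φ i ⁅S.ξ k, S.ξ i⁆ = ⁅S.ξ i, S.ξ j⁆ := by
  rw [← lie_skew, map_neg, ← S.abelian_ad, S.comp_xi' k i j h.rotate.rotate, lie_neg, neg_neg]

theorem eta_lie_xi_next (h : evenPerm i j k) : S.η i ⁅S.ξ i, S.ξ j⁆ = 0 := by
  rw [← phi_lie_xi_prev h, S.eta_phi_self]

/-- The vector `φ_i [ξ_j, ξ_k]` is the same for all even permutations `(i, j, k)`. -/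
theorem phi_lie_xi_rotate (h : evenPerm i j k) :
    S.φ i ⁅S.ξ j, S.ξ k⁆ = S.φ j ⁅S.ξ k, S.ξ i⁆ := by
  have h1 := phi_lie_xi_next (S := S) h.rotate.rotate
  have h2 := S.comp_phi' k i j h.rotate.rotate ⁅S.ξ k, S.ξ i⁆
  rw [h1, eta_lie_xi_next h.rotate.rotate, zero_smul, add_zero, map_neg, neg_neg] at h2
  exact h2.symm

/-- On horizontal vectors, `[ξ_i, φ_i X]` does not depend on `i`. -/
theorem lie_xi_phi_rotate (h : evenPerm i j k) {X : L} (hX : S.inH X) :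
    ⁅S.ξ j, S.φ j X⁆ = ⁅S.ξ k, S.φ k X⁆ := by
  have h1 := S.abelian_br i (S.φ j X) (S.ξ j)
    (by rw [S.comp_eta i j k h, hX k]) (eta_xi_next h)
  rw [S.comp_xi i j k h] at h1
  have h2 := S.comp_phi i j k h X
  rw [hX j, zero_smul, sub_zero] at h2
  rw [h2, ← lie_skew, ← h1, lie_skew]

theorem Z_eq (h : evenPerm i j k) : S.Z = S.φ i ⁅S.ξ j, S.ξ k⁆ := by
  have h0 : evenPerm 0 1 2 := Or.inl rfl
  rcases h with h | h | h <;> cases h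
  · rfl
  · exact phi_lie_xi_rotate h0
  · exact (phi_lie_xi_rotate h0).trans (phi_lie_xi_rotate h0.rotate)

theorem exists_evenPerm (i : Fin 3) : ∃ j k, evenPerm i j k := by
  fin_cases i
  exacts [⟨1, 2, Or.inl rfl⟩, ⟨2, 0, Or.inr (Or.inl rfl)⟩, ⟨0, 1, Or.inr (Or.inr rfl)⟩]

variable (S) in
theorem Z_inH : S.inH S.Z := by
  intro i
  obtain ⟨j, k, h⟩ := exists_evenPerm i
  rw [Z_eq h, S.eta_phi_self]

theorem lie_xi_lie_xi (h : evenPerm i j k) :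
    ⁅S.ξ i, ⁅S.ξ j, S.ξ k⁆⁆ = -⁅S.ξ i, S.φ i S.Z⁆ := by
  rw [Z_eq h, S.acs, lie_add, lie_neg, lie_smul, lie_self, smul_zero, add_zero, neg_neg]

variable (S) in
theorem lie_xi_phi_Z (i : Fin 3) : ⁅S.ξ i, S.φ i S.Z⁆ = 0 := by
  obtain ⟨j, k, h⟩ := exists_evenPerm i
  have h1 := lie_jacobi (S.ξ i) (S.ξ j) (S.ξ k)
  rw [lie_xi_lie_xi h, lie_xi_lie_xi h.rotate, lie_xi_lie_xi h.rotate.rotate,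
    ← lie_xi_phi_rotate h S.Z_inH, ← lie_xi_phi_rotate h.rotate.rotate S.Z_inH] at h1
  have h2 : (3 : ℝ) • ⁅S.ξ i, S.φ i S.Z⁆ = 0 := by
    rw [← neg_eq_zero, ← h1]
    module
  exact (smul_eq_zero.mp h2).resolve_left (by norm_num)

variable (S) in
theorem lie_xi_Z (i : Fin 3) : ⁅S.ξ i, S.Z⁆ = 0 := by
  have h := S.acs i S.Z
  rw [S.Z_inH i, zero_smul, add_zero] at h
  rw [← neg_eq_zero, ← lie_neg, ← h, S.abelian_ad, S.lie_xi_phi_Z, map_zero]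

end AbelianAC3

/-- `ψ(𝒵) = 0`, hence `[ξ_i, 𝒵] = 0` for all `i` and `[ξ, 𝒵] = 0` for
every `ξ` in the vertical subspace `𝔳`. -/
theorem AbelianAC3.Z_vertical_invariant
    {L : Type*} [LieRing L] [LieAlgebra ℝ L] [FiniteDimensional ℝ L]
    (S : AbelianAC3 L) :
    S.φ 0 ⁅S.ξ 0, S.Z⁆ = 0 ∧ (∀ i, ⁅S.ξ i, S.Z⁆ = 0) ∧
      ∀ v ∈ S.V, ⁅v, S.Z⁆ = 0 := by
  refine ⟨by rw [S.lie_xi_Z, map_zero], S.lie_xi_Z, fun v hv => ?_⟩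
  refine Submodule.span_induction ?_ (zero_lie _) (fun x y _ _ hx hy => ?_)
    (fun a x _ hx => ?_) hv
  · rintro x (rfl | rfl | rfl) <;> exact S.lie_xi_Z _
  · rw [add_lie, hx, hy, add_zero]
  · rw [smul_lie, hx, smul_zero]
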